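/- arXiv:2111.02921 — 2 statements merged into one kernel-verified Lean document; each statement's English description precedes it below -/
import Mathlib

section
/- Let U ≥ 1, let h ∈ ℂ^U and let H = diag(h) be the diagonal matrix with entries h. Let p, q ∈ ℝ^U have nonnegative entries, and set A_p = diag(√p₁, …, √p_U) and A_q = diag(√q₁, …, √q_U). Let S_p, S_q ⊆ ℂ^U be finite sets, each with at least two elements, such that d_min(H·A_p, S_p) ≥ d_min(H·A_p, S_q) and d_min(H·A_q, S_q) ≥ d_min(H·A_q, S_p) (each constellation is optimal for its own power matrix among the two), and assume d_min(H·A_p, S_p) > 0. Let (s₁, s̃₁) be a pair of distinct points of S_p attaining d_min(H·A_p, S_p), (s₂, s̃₂) a pair of distinct points of S_q attaining d_min(H·A_p, S_q), (s₃, s̃₃) a pair of distinct points of S_p attaining d_min(H·A_q, S_p), and (s₄, s̃₄) a pair of distinct points of S_q attaining d_min(H·A_q, S_q); set S_d = {s₁ − s̃₁, s₂ − s̃₂, s₃ − s̃₃, s₄ − s̃₄} and assume ‖H·A_p·s_d‖₂ > 0 for every s_d ∈ S_d. Then |1 − d_min(H·A_q, S_q)/d_min(H·A_p, S_p)| ≤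 ‖p − q‖₂ · max over s_d ∈ S_d of (‖H·s_d‖₂² / ‖H·A_p·s_d‖₂²). -/
open scoped BigOperators

/-- Euclidean norm of a complex vector. -/
noncomputable def euclNorm {U : ℕ} (v : Fin U → ℂ) : ℝ :=
  Real.sqrt (∑ i, ‖v i‖ ^ 2)

/-- Euclidean norm of a real vector. -/
noncomputable def euclNormR {U : ℕ} (v : Fin U → ℝ) : ℝ :=
  Real.sqrt (∑ i, (v i) ^ 2)

/-- Minimum Euclidean distance of a constellation `C` under channel matrix `M`. -/
noncomputable def dmin {U : ℕ} (M : Matrix (Fin U) (Fin U) ℂ) (C : Finset (Fin U → ℂ)) : ℝ :=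
  sInf {d : ℝ | ∃ x ∈ C, ∃ y ∈ C, x ≠ y ∧ d = euclNorm (M.mulVec (x - y))}

lemma euclNorm_nonneg' {U : ℕ} (v : Fin U → ℂ) : 0 ≤ euclNorm v := Real.sqrt_nonneg _

lemma euclNorm_sq' {U : ℕ} (v : Fin U → ℂ) : euclNorm v ^ 2 = ∑ i, ‖v i‖ ^ 2 :=
  Real.sq_sqrt (Finset.sum_nonneg fun _ _ => sq_nonneg _)

lemma dmin_le' {U : ℕ} (M : Matrix (Fin U) (Fin U) ℂ) (C : Finset (Fin U → ℂ))
    (x y : Fin U → ℂ) (hx : x ∈ C) (hy : y ∈ C) (hne : x ≠ y) :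
    dmin M C ≤ euclNorm (M.mulVec (x - y)) := by
  refine csInf_le ⟨0, ?_⟩ ⟨x, hx, y, hy, hne, rfl⟩
  rintro d ⟨x, _, y, _, _, rfl⟩
  exact euclNorm_nonneg' _

lemma diag_sq' {U : ℕ} (h : Fin U → ℂ) (p : Fin U → ℝ) (hp : ∀ i, 0 ≤ p i) (s : Fin U → ℂ) :
    euclNorm ((Matrix.diagonal h * Matrix.diagonal fun i => (Real.sqrt (p i) : ℂ)).mulVec s) ^ 2
      = ∑ i, p i * ‖h i * s i‖ ^ 2 := by
  rw [euclNorm_sq', Matrix.diagonal_mul_diagonal]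
  refine Finset.sum_congr rfl fun i _ => ?_
  rw [Matrix.mulVec_diagonal]
  simp only [norm_mul, Complex.norm_real, Real.norm_eq_abs, mul_pow, sq_abs, Real.sq_sqrt (hp i)]
  ring

lemma diff_sq' {U : ℕ} (h : Fin U → ℂ) (p q : Fin U → ℝ) (hp : ∀ i, 0 ≤ p i)
    (hq : ∀ i, 0 ≤ q i) (s : Fin U → ℂ) :
    |euclNorm ((Matrix.diagonal h * Matrix.diagonal fun i => (Real.sqrt (p i) : ℂ)).mulVec s) ^ 2
     - euclNorm ((Matrix.diagonal h * Matrix.diagonal fun i => (Real.sqrt (q i) : ℂ)).mulVec s) ^ 2|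
      ≤ euclNormR (p - q) * euclNorm ((Matrix.diagonal h).mulVec s) ^ 2 := by
  rw [diag_sq' h p hp, diag_sq' h q hq, euclNorm_sq', ← Finset.sum_sub_distrib, Finset.mul_sum]
  refine (Finset.abs_sum_le_sum_abs _ _).trans (Finset.sum_le_sum fun i _ => ?_)
  rw [Matrix.mulVec_diagonal, ← sub_mul, abs_mul, abs_of_nonneg (sq_nonneg ‖h i * s i‖)]
  refine mul_le_mul_of_nonneg_right ?_ (sq_nonneg _)
  refine Real.abs_le_sqrt ?_
  exact Finset.single_le_sum (f := fun i => ((p - q) i) ^ 2) (fun _ _ => sq_nonneg _)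
    (Finset.mem_univ i)

lemma le_of_sq_aux {a b : ℝ} (h : a ^ 2 ≤ b ^ 2) (hb : 0 ≤ b) : a ≤ b :=
  (abs_le_of_sq_le_sq' h hb).2

/-- Theorem 2: for a diagonal parallel channel `H = diag h`, the normalized MED loss of using
power allocation `q` with its own optimal constellation `S_q` instead of the power allocation
`p` with its optimal constellation `S_p` is bounded by `‖p − q‖₂` times a finite factor. -/
theorem dmin_diff_power_allocation
    (U : ℕ) (hU : 1 ≤ U) (h : Fin U → ℂ)
    (H : Matrix (Fin U) (Fin U) ℂ) (hH : H = Matrix.diagonal h)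
    (p q : Fin U → ℝ) (hp : ∀ i, 0 ≤ p i) (hq : ∀ i, 0 ≤ q i)
    (Ap Aq : Matrix (Fin U) (Fin U) ℂ)
    (hAp : Ap = Matrix.diagonal fun i => (Real.sqrt (p i) : ℂ))
    (hAq : Aq = Matrix.diagonal fun i => (Real.sqrt (q i) : ℂ))
    (Sp Sq : Finset (Fin U → ℂ))
    (hSp : 2 ≤ Sp.card) (hSq : 2 ≤ Sq.card)
    -- each constellation is optimal for its own power matrix among the two
    (hoptp : dmin (H * Ap) Sq ≤ dmin (H * Ap) Sp)
    (hoptq : dmin (H * Aq) Sp ≤ dmin (H * Aq) Sq)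
    (hpos : 0 < dmin (H * Ap) Sp)
    -- `(s₁, s₁')` attains `dmin(H·A_p, S_p)`
    (s₁ s₁' : Fin U → ℂ) (hs₁ : s₁ ∈ Sp) (hs₁' : s₁' ∈ Sp) (hs₁ne : s₁ ≠ s₁')
    (hs₁att : euclNorm ((H * Ap).mulVec (s₁ - s₁')) = dmin (H * Ap) Sp)
    -- `(s₂, s₂')` attains `dmin(H·A_p, S_q)`
    (s₂ s₂' : Fin U → ℂ) (hs₂ : s₂ ∈ Sq) (hs₂' : s₂' ∈ Sq) (hs₂ne : s₂ ≠ s₂')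
    (hs₂att : euclNorm ((H * Ap).mulVec (s₂ - s₂')) = dmin (H * Ap) Sq)
    -- `(s₃, s₃')` attains `dmin(H·A_q, S_p)`
    (s₃ s₃' : Fin U → ℂ) (hs₃ : s₃ ∈ Sp) (hs₃' : s₃' ∈ Sp) (hs₃ne : s₃ ≠ s₃')
    (hs₃att : euclNorm ((H * Aq).mulVec (s₃ - s₃')) = dmin (H * Aq) Sp)
    -- `(s₄, s₄')` attains `dmin(H·A_q, S_q)`
    (s₄ s₄' : Fin U → ℂ) (hs₄ : s₄ ∈ Sq) (hs₄' : s₄' ∈ Sq) (hs₄ne : s₄ ≠ s₄')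
    (hs₄att : euclNorm ((H * Aq).mulVec (s₄ - s₄')) = dmin (H * Aq) Sq)
    -- the difference set `S_d` and the nondegeneracy assumption on it
    (Sd : Set (Fin U → ℂ))
    (hSd : Sd = {s₁ - s₁', s₂ - s₂', s₃ - s₃', s₄ - s₄'})
    (hSdpos : ∀ sd ∈ Sd, 0 < euclNorm ((H * Ap).mulVec sd)) :
    |1 - dmin (H * Aq) Sq / dmin (H * Ap) Sp| ≤
      euclNormR (p - q) *
        max (max (euclNorm (H.mulVec (s₁ - s₁')) ^ 2 / euclNorm ((H * Ap).mulVec (s₁ - s₁')) ^ 2)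
                 (euclNorm (H.mulVec (s₂ - s₂')) ^ 2 / euclNorm ((H * Ap).mulVec (s₂ - s₂')) ^ 2))
            (max (euclNorm (H.mulVec (s₃ - s₃')) ^ 2 / euclNorm ((H * Ap).mulVec (s₃ - s₃')) ^ 2)
                 (euclNorm (H.mulVec (s₄ - s₄')) ^ 2 / euclNorm ((H * Ap).mulVec (s₄ - s₄')) ^ 2)) := by
  have h2p : 0 < euclNorm ((H * Ap).mulVec (s₂ - s₂')) := hSdpos _ (by simp [hSd])
  have h3p : 0 < euclNorm ((H * Ap).mulVec (s₃ - s₃')) := hSdpos _ (by simp [hSd])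
  have d2 := diff_sq' h p q hp hq (s₂ - s₂')
  have d3 := diff_sq' h p q hp hq (s₃ - s₃')
  rw [← hH, ← hAp, ← hAq] at d2 d3
  have e2 := dmin_le' (H * Aq) Sq s₂ s₂' hs₂ hs₂' hs₂ne
  have e3 := dmin_le' (H * Ap) Sp s₃ s₃' hs₃ hs₃' hs₃ne
  have hDq : 0 ≤ dmin (H * Aq) Sq := hs₄att ▸ euclNorm_nonneg' _
  have hD : 0 ≤ euclNormR (p - q) := Real.sqrt_nonneg _
  rw [← hs₂att] at hoptp
  rw [← hs₃att] at hoptq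
  have n3 : 0 ≤ euclNorm ((H * Aq).mulVec (s₃ - s₃')) := euclNorm_nonneg' _
  set R := max (max (euclNorm (H.mulVec (s₁ - s₁')) ^ 2 / euclNorm ((H * Ap).mulVec (s₁ - s₁')) ^ 2)
                 (euclNorm (H.mulVec (s₂ - s₂')) ^ 2 / euclNorm ((H * Ap).mulVec (s₂ - s₂')) ^ 2))
            (max (euclNorm (H.mulVec (s₃ - s₃')) ^ 2 / euclNorm ((H * Ap).mulVec (s₃ - s₃')) ^ 2)
                 (euclNorm (H.mulVec (s₄ - s₄')) ^ 2 / euclNorm ((H * Ap).mulVec (s₄ - s₄')) ^ 2))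
    with hR
  have r2 : euclNorm (H.mulVec (s₂ - s₂')) ^ 2 / euclNorm ((H * Ap).mulVec (s₂ - s₂')) ^ 2 ≤ R :=
    (le_max_right _ _).trans (le_max_left _ _)
  have r3 : euclNorm (H.mulVec (s₃ - s₃')) ^ 2 / euclNorm ((H * Ap).mulVec (s₃ - s₃')) ^ 2 ≤ R :=
    (le_max_left _ _).trans (le_max_right _ _)
  clear_value R
  have hR0 : 0 ≤ R := le_trans (by positivity) r2
  rw [div_le_iff₀ (by positivity)] at r2 r3
  have m2 := d2.trans (mul_le_mul_of_nonneg_left r2 hD)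
  have m3 := d3.trans (mul_le_mul_of_nonneg_left r3 hD)
  rw [← mul_assoc] at m2 m3
  have ht : 0 ≤ euclNormR (p - q) * R := mul_nonneg hD hR0
  generalize euclNormR (p - q) * R = t at *
  generalize dmin (H * Aq) Sq = Dq at *
  generalize dmin (H * Ap) Sp = Dp at *
  generalize euclNorm ((H * Ap).mulVec (s₂ - s₂')) = a2 at *
  generalize euclNorm ((H * Aq).mulVec (s₂ - s₂')) = b2 at *
  generalize euclNorm ((H * Ap).mulVec (s₃ - s₃')) = a3 at *
  generalize euclNorm ((H * Aq).mulVec (s₃ - s₃')) = b3 at *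
  rw [abs_le] at m2 m3
  have up : Dq ≤ (1 + t) * Dp := by
    refine le_of_sq_aux ?_ (by positivity)
    have k1 : Dq ^ 2 ≤ b2 ^ 2 := pow_le_pow_left₀ hDq e2 2
    have k2 : a2 ^ 2 ≤ Dp ^ 2 := pow_le_pow_left₀ h2p.le hoptp 2
    calc Dq ^ 2 ≤ (1 + t) * a2 ^ 2 := by linarith [m2.1]
      _ ≤ (1 + t) * Dp ^ 2 := by gcongr
      _ ≤ ((1 + t) * Dp) ^ 2 := by nlinarith [mul_nonneg ht (sq_nonneg Dp), mul_nonneg (mul_nonneg ht ht) (sq_nonneg Dp)]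
  have lo : (1 - t) * Dp ≤ Dq := by
    rcases le_total t 1 with h1 | h1
    · have h1' : 0 ≤ 1 - t := by linarith
      refine le_of_sq_aux ?_ hDq
      have k1 : b3 ^ 2 ≤ Dq ^ 2 := pow_le_pow_left₀ n3 hoptq 2
      have k2 : Dp ^ 2 ≤ a3 ^ 2 := pow_le_pow_left₀ hpos.le e3 2
      calc ((1 - t) * Dp) ^ 2 ≤ (1 - t) * Dp ^ 2 := by
            nlinarith [mul_nonneg (mul_nonneg ht h1') (sq_nonneg Dp)]
        _ ≤ (1 - t) * a3 ^ 2 := by gcongr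
        _ ≤ Dq ^ 2 := by linarith [m3.2]
    · exact le_trans (mul_nonpos_of_nonpos_of_nonneg (by linarith) hpos.le) hDq
  rw [← div_le_iff₀ hpos] at up
  rw [← le_div_iff₀ hpos] at lo
  rw [abs_le]
  constructor <;> linarith
end

section
/- Fix z_R > 0, λ_a > 0 and a nonzero mode l_m ∈ ℤ. For a wavelength λ_i > 0, modes l₁, l₂ ∈ ℤ with l₁ ≠ 0, z > 0 and β > 0, the link gain ratio between the two sub-channels with the same wavelength λ_i and modes l₁, l₂ at the position (β·r_max(λ_a, l_m, z), z) satisfies the exact identity g(λ_i, l₁, β·r_max(λ_a, l_m, z), z) / g(λ_i, l₂, β·r_max(λ_a, l_m, z), z) = (d_m(λ_i, l₂, z)² / d_m(λ_i, l₁, z)²) · (λ_a·|l_m|·β²/λ_i)^{|l₁|−|l₂|} · (|l₂|^{|l₂|} / |l₁|^{|l₁|}) · e^{|l₁|−|l₂|}, where d_m(λ, 0, z) = z and the convention 0⁰ = 1 is used when l₂ = 0. -/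
open scoped BigOperators

/-- Squared beam waist: `ω(λ)² = λ·z_R/π`. -/
noncomputable def waistSq (zR lam : ℝ) : ℝ := lam * zR / Real.pi

/-- Squared beam spot at axial distance `z`: `ω(λ,z)² = ω(λ)²·(1 + z²/z_R²)`. -/
noncomputable def spotSq (zR lam z : ℝ) : ℝ := waistSq zR lam * (1 + z ^ 2 / zR ^ 2)

/-- Maximum-strength radius `r_max(λ,l,z) = √(|l|/2)·ω(λ,z)`. -/
noncomputable def rmax (zR lam : ℝ) (l : ℤ) (z : ℝ) : ℝ :=
  Real.sqrt ((l.natAbs : ℝ) / 2 * spotSq zR lam z)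

/-- `d_m(λ,l,z) = √(r_max(λ,l,z)² + z²)`; in particular `d_m(λ,0,z) = z` for `z > 0`. -/
noncomputable def dm (zR lam : ℝ) (l : ℤ) (z : ℝ) : ℝ :=
  Real.sqrt (rmax zR lam l z ^ 2 + z ^ 2)

/-- OAM link gain at radius `r` and axial distance `z` (Equation (2) of the paper). -/
noncomputable def gain (zR lam : ℝ) (l : ℤ) (r z : ℝ) : ℝ :=
  if l = 0 then
    lam ^ 2 / ((4 * Real.pi) ^ 2 * z ^ 2) * Real.exp (-2 * r ^ 2 / spotSq zR lam z)
  else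
    lam ^ 2 / ((4 * Real.pi) ^ 2 * dm zR lam l z ^ 2) *
      (r / rmax zR lam l z) ^ (2 * l.natAbs) *
      Real.exp (2 * (rmax zR lam l z ^ 2 - r ^ 2) / spotSq zR lam z)

lemma spotSq_pos_aux (zR lam z : ℝ) (hzR : 0 < zR) (hlam : 0 < lam) : 0 < spotSq zR lam z := by
  unfold spotSq waistSq
  have := Real.pi_pos
  positivity

lemma rmax_sq_aux (zR lam : ℝ) (l : ℤ) (z : ℝ) (hzR : 0 < zR) (hlam : 0 < lam) :
    rmax zR lam l z ^ 2 = (l.natAbs : ℝ) / 2 * spotSq zR lam z := by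
  have := spotSq_pos_aux zR lam z hzR hlam
  unfold rmax
  rw [Real.sq_sqrt (by positivity)]

lemma dm_sq_aux (zR lam : ℝ) (l : ℤ) (z : ℝ) :
    dm zR lam l z ^ 2 = rmax zR lam l z ^ 2 + z ^ 2 := by
  unfold dm
  rw [Real.sq_sqrt (by positivity)]

/-- A uniform formula for the gain, valid for every mode including zero. -/
lemma gain_uniform_aux (zR lamA : ℝ) (lm : ℤ) (hzR : 0 < zR) (hlamA : 0 < lamA)
    (lamI : ℝ) (hlamI : 0 < lamI) (l : ℤ) (z β : ℝ) :
    gain zR lamI l (β * rmax zR lamA lm z) z =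
      lamI ^ 2 / ((4 * Real.pi) ^ 2 * dm zR lamI l z ^ 2) *
      ((lamA * (lm.natAbs : ℝ) * β ^ 2 / lamI) ^ l.natAbs / (l.natAbs : ℝ) ^ l.natAbs) *
      (Real.exp (l.natAbs : ℝ) *
        Real.exp (-2 * (β * rmax zR lamA lm z) ^ 2 / spotSq zR lamI z)) := by
  have hS := spotSq_pos_aux zR lamI z hzR hlamI
  by_cases hl : l = 0
  · subst hl
    simp [gain, dm_sq_aux, rmax_sq_aux zR lamI 0 z hzR hlamI]
  · have hn : (0 : ℝ) < (l.natAbs : ℝ) := by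
      exact_mod_cast Int.natAbs_pos.mpr hl
    unfold gain
    rw [if_neg hl, ← Real.exp_add, ← div_pow, pow_mul]
    have h1 : (β * rmax zR lamA lm z / rmax zR lamI l z) ^ 2 =
        lamA * (lm.natAbs : ℝ) * β ^ 2 / lamI / (l.natAbs : ℝ) := by
      rw [div_pow, mul_pow, rmax_sq_aux zR lamA lm z hzR hlamA,
        rmax_sq_aux zR lamI l z hzR hlamI]
      have hpi := Real.pi_pos
      have hw : 0 < 1 + z ^ 2 / zR ^ 2 := by positivity
      unfold spotSq waistSq
      generalize 1 + z ^ 2 / zR ^ 2 = w at hw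
      field_simp
    have h2 : 2 * (rmax zR lamI l z ^ 2 - (β * rmax zR lamA lm z) ^ 2) / spotSq zR lamI z =
        (l.natAbs : ℝ) + -2 * (β * rmax zR lamA lm z) ^ 2 / spotSq zR lamI z := by
      rw [rmax_sq_aux zR lamI l z hzR hlamI]
      field_simp
      ring
    rw [h1, h2]

/-- Equation (10), exact form: the same-wavelength, cross-mode link gain ratio at position
`(β·r_max(λ_a, l_m, z), z)`, with `d_m(λ,0,z) = z` and the convention `0⁰ = 1` when `l₂ = 0`. -/
theorem gain_ratio_cross_mode
    (zR lamA : ℝ) (lm : ℤ) (hzR : 0 < zR) (hlamA : 0 < lamA) (hlm : lm ≠ 0)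
    (lamI : ℝ) (hlamI : 0 < lamI) (l₁ l₂ : ℤ) (hl₁ : l₁ ≠ 0)
    (z β : ℝ) (hz : 0 < z) (hβ : 0 < β) :
    gain zR lamI l₁ (β * rmax zR lamA lm z) z / gain zR lamI l₂ (β * rmax zR lamA lm z) z =
      (dm zR lamI l₂ z ^ 2 / dm zR lamI l₁ z ^ 2) *
        (lamA * (lm.natAbs : ℝ) * β ^ 2 / lamI) ^ ((l₁.natAbs : ℤ) - (l₂.natAbs : ℤ)) *
        ((l₂.natAbs : ℝ) ^ l₂.natAbs / (l₁.natAbs : ℝ) ^ l₁.natAbs) *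
        Real.exp ((l₁.natAbs : ℝ) - (l₂.natAbs : ℝ)) := by
  rw [gain_uniform_aux zR lamA lm hzR hlamA lamI hlamI l₁ z β,
    gain_uniform_aux zR lamA lm hzR hlamA lamI hlamI l₂ z β]
  have hm : (0 : ℝ) < (lm.natAbs : ℝ) := by
    exact_mod_cast Int.natAbs_pos.mpr hlm
  have hX : 0 < lamA * (lm.natAbs : ℝ) * β ^ 2 / lamI := by positivity
  have hd₁ : 0 < dm zR lamI l₁ z ^ 2 := by rw [dm_sq_aux]; positivity
  have hd₂ : 0 < dm zR lamI l₂ z ^ 2 := by rw [dm_sq_aux]; positivity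
  have hp₁ : (0 : ℝ) < (l₁.natAbs : ℝ) ^ l₁.natAbs := by
    have := Nat.pow_self_pos (n := l₁.natAbs)
    exact_mod_cast this
  have hp₂ : (0 : ℝ) < (l₂.natAbs : ℝ) ^ l₂.natAbs := by
    have := Nat.pow_self_pos (n := l₂.natAbs)
    exact_mod_cast this
  rw [zpow_sub₀ hX.ne', zpow_natCast, zpow_natCast, Real.exp_sub]
  have hA := pow_pos hX l₁.natAbs
  have hB := pow_pos hX l₂.natAbs
  have hE := Real.exp_pos (-2 * (β * rmax zR lamA lm z) ^ 2 / spotSq zR lamI z)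
  have hE₂ := Real.exp_pos (l₂.natAbs : ℝ)
  have hpi := Real.pi_pos
  generalize Real.exp (-2 * (β * rmax zR lamA lm z) ^ 2 / spotSq zR lamI z) = E at *
  generalize Real.exp (l₂.natAbs : ℝ) = E₂ at *
  generalize Real.exp (l₁.natAbs : ℝ) = E₁ at *
  generalize (lamA * (lm.natAbs : ℝ) * β ^ 2 / lamI) ^ l₁.natAbs = A at *
  generalize (lamA * (lm.natAbs : ℝ) * β ^ 2 / lamI) ^ l₂.natAbs = B at *
  generalize (l₁.natAbs : ℝ) ^ l₁.natAbs = P₁ at *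
  generalize (l₂.natAbs : ℝ) ^ l₂.natAbs = P₂ at *
  generalize dm zR lamI l₁ z ^ 2 = D₁ at *
  generalize dm zR lamI l₂ z ^ 2 = D₂ at *
  field_simp
end
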